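/- arXiv:2507.01027 — 6 statements merged into one kernel-verified Lean document; each statement's English description precedes it below -/
import Mathlib

section
/- Under the part-1 setup, the binarization scale of w satisfies α(w) = (1/n)·Σ_{i=1}^n |w_i − β(w)| = (A + (n−2k)·A/n)/n = 2A(n−k)/n². -/
open Finset

/-- Binarization shift: `β(w) = (1/n)·Σ_i w_i`. -/
noncomputable def bShift {n : ℕ} (w : Fin n → ℝ) : ℝ :=
  (1 / (n : ℝ)) * ∑ i, w i

/-- Binarization scale: `α(w) = (1/n)·Σ_i |w_i − β(w)|`. -/
noncomputable def bScale {n : ℕ} (w : Fin n → ℝ) : ℝ :=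
  (1 / (n : ℝ)) * ∑ i, |w i - bShift w|

/-- Sign function: `+1` if `t > 0`, `−1` if `t ≤ 0`. -/
noncomputable def bSign (t : ℝ) : ℝ :=
  if t > 0 then 1 else -1

/-- Dequantized vector: `deq(w)_i = α(w)·Sign(w_i − β(w)) + β(w)`. -/
noncomputable def bDeq {n : ℕ} (w : Fin n → ℝ) : Fin n → ℝ :=
  fun i => bScale w * bSign (w i - bShift w) + bShift w

theorem Fin.sum_eq_sum_castLE_add_sum {M : Type*} [AddCommMonoid M] {n k : ℕ} (h : k ≤ n)
    (f : Fin n → M) :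
    ∑ i, f i = (∑ i : Fin k, f ⟨i, by omega⟩) + ∑ j : Fin (n - k), f ⟨k + j, by omega⟩ := by
  obtain ⟨m, rfl⟩ := Nat.exists_eq_add_of_le h
  rw [Fin.sum_univ_add]
  congr 1
  exact Fintype.sum_equiv (finCongr (by omega)) _ _ fun _ => rfl

theorem stmt_1 (n k : ℕ) (hk : 1 ≤ k) (hkn : 2 * k < n)
    (A : ℝ) (hA : 0 < A)
    (a : Fin k → ℝ) (hasum : ∑ i, a i = A) (halarge : ∀ i, A / n < a i)
    (b : Fin (n - k) → ℝ) (hbsum : ∑ j, b j = 0) (hbsmall : ∀ j, b j ≤ A / n)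
    (w : Fin n → ℝ)
    (hw1 : ∀ i : Fin k, w ⟨i, by omega⟩ = a i)
    (hw2 : ∀ j : Fin (n - k), w ⟨k + j, by omega⟩ = b j) :
    bScale w = (A + ((n : ℝ) - 2 * k) * A / n) / n ∧
      bScale w = 2 * A * ((n : ℝ) - k) / (n : ℝ) ^ 2 := by
  have hkn' : k ≤ n := by omega
  have hn : (n : ℝ) ≠ 0 := by
    have : n ≠ 0 := by omega
    exact_mod_cast this
  have hshift : bShift w = A / n := by
    rw [bShift, Fin.sum_eq_sum_castLE_add_sum hkn']
    simp only [hw1, hw2, hasum, hbsum]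
    ring
  have hlarge : ∀ i, |a i - A / n| = a i - A / n := fun i =>
    abs_of_pos (sub_pos.2 (halarge i))
  have hsmall : ∀ j, |b j - A / n| = A / n - b j := fun j => by
    rw [abs_of_nonpos (sub_nonpos.2 (hbsmall j)), neg_sub]
  have hscale : bScale w = (1 / (n : ℝ)) * ((A - k * (A / n)) + (n - k) * (A / n)) := by
    rw [bScale, hshift, Fin.sum_eq_sum_castLE_add_sum hkn']
    simp only [hw1, hw2, hlarge, hsmall, Finset.sum_sub_distrib, hasum, hbsum, Finset.sum_const,
      Finset.card_univ, Fintype.card_fin, nsmul_eq_mul, Nat.cast_sub hkn', sub_zero]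
  rw [hscale]
  constructor <;> field_simp <;> ring
end

section
/- Under the part-1 setup, the dequantized vector of w takes exactly two values determined by the position: deq(w)_i = α(w) + β(w) for every position i ≤ k (the positions holding a_1, …, a_k), and deq(w)_i = −α(w) + β(w) for every position i > k (the positions holding b_1, …, b_{n−k}). -/
open Finset

/-- A sum over `Fin n` splits at position `k` into an initial and a final segment. -/
theorem Fin.sum_univ_eq_sum_initial_add_sum_final {M : Type*} [AddCommMonoid M] {n k : ℕ}
    (hkn : k ≤ n) (w : Fin n → M) :
    ∑ i, w i = ∑ i : Fin k, w ⟨i, by omega⟩ + ∑ j : Fin (n - k), w ⟨k + j, by omega⟩ := by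
  rw [← Equiv.sum_comp (finCongr (Nat.add_sub_cancel' hkn)) w, Fin.sum_univ_add]
  rfl

theorem stmt_2 (n k : ℕ) (hk : 1 ≤ k) (hkn : 2 * k < n)
    (A : ℝ) (hA : 0 < A)
    (a : Fin k → ℝ) (hasum : ∑ i, a i = A) (halarge : ∀ i, A / n < a i)
    (b : Fin (n - k) → ℝ) (hbsum : ∑ j, b j = 0) (hbsmall : ∀ j, b j ≤ A / n)
    (w : Fin n → ℝ)
    (hw1 : ∀ i : Fin k, w ⟨i, by omega⟩ = a i)
    (hw2 : ∀ j : Fin (n - k), w ⟨k + j, by omega⟩ = b j) :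
    (∀ i : Fin n, (i : ℕ) < k → bDeq w i = bScale w + bShift w) ∧
      (∀ i : Fin n, k ≤ (i : ℕ) → bDeq w i = -bScale w + bShift w) := by
  have hshift : bShift w = A / n := by
    rw [bShift, Fin.sum_univ_eq_sum_initial_add_sum_final (by omega : k ≤ n) w]
    simp only [hw1, hw2, hasum, hbsum]
    ring
  refine ⟨fun i hi => ?_, fun i hi => ?_⟩
  · have hpos : w i - bShift w > 0 := by
      rw [hshift, gt_iff_lt, sub_pos]
      exact (halarge ⟨i, hi⟩).trans_eq (hw1 ⟨i, hi⟩).symm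
    rw [bDeq, bSign, if_pos hpos, mul_one]
  · have hle : ¬ w i - bShift w > 0 := by
      rw [hshift, gt_iff_lt, sub_pos, not_lt]
      have hwi := hw2 ⟨i - k, by omega⟩
      simp only [Nat.add_sub_cancel' hi] at hwi
      exact hwi.trans_le (hbsmall _)
    rw [bDeq, bSign, if_neg hle, mul_neg_one]
end

section
/- Under the part-1 setup, let m > 1 be a real number with m·b_j ≤ A/n for every j, and let w_new ∈ ℝⁿ be the vector whose first k entries are a_1, …, a_k and whose last n−k entries are m·b_1, …, m·b_{n−k}. Then scaling up the small entries leaves the binarization parameters unchanged: β(w_new) = β(w), α(w_new) = α(w), and deq(w_new)_i = deq(w)_i for every i. -/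
open Finset

/-- A sum over `Fin n` splits into the first `k` and the last `d` indices when `k + d = n`. -/
lemma sum_fin_eq_head_add_tail {n k d : ℕ} (h : k + d = n) (f : Fin n → ℝ) :
    ∑ i, f i = ∑ i : Fin k, f ⟨i, by omega⟩ + ∑ j : Fin d, f ⟨k + j, by omega⟩ := by
  subst h
  exact Fin.sum_univ_add f

lemma bShift_eq_of_tail_sum_zero
    {n k d : ℕ} (h : k + d = n) {A : ℝ} {a : Fin k → ℝ} {c : Fin d → ℝ} {v : Fin n → ℝ}
    (hasum : ∑ i, a i = A) (hcsum : ∑ j, c j = 0)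
    (hv1 : ∀ i : Fin k, v ⟨i, by omega⟩ = a i)
    (hv2 : ∀ j : Fin d, v ⟨k + j, by omega⟩ = c j) : bShift v = A / n := by
  rw [bShift, sum_fin_eq_head_add_tail h]
  simp only [hv1, hv2, hasum, hcsum]
  ring

/-- If the head lies above the shift and the tail below it, the scale does not depend on the
individual tail entries. -/
lemma bScale_eq_of_tail_sum_zero
    {n k d : ℕ} (h : k + d = n) {A : ℝ} {a : Fin k → ℝ} {c : Fin d → ℝ} {v : Fin n → ℝ}
    (hasum : ∑ i, a i = A) (hcsum : ∑ j, c j = 0)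
    (hv1 : ∀ i : Fin k, v ⟨i, by omega⟩ = a i)
    (hv2 : ∀ j : Fin d, v ⟨k + j, by omega⟩ = c j)
    (ha : ∀ i, A / n < a i) (hc : ∀ j, c j ≤ A / n) :
    bScale v = (1 / (n : ℝ)) * ((A - k * (A / n)) + d * (A / n)) := by
  rw [bScale, bShift_eq_of_tail_sum_zero h hasum hcsum hv1 hv2, sum_fin_eq_head_add_tail h]
  have head : ∀ i, |a i - A / n| = a i - A / n := fun i => abs_of_pos (sub_pos.2 (ha i))
  have tail : ∀ j, |c j - A / n| = A / n - c j := fun j => by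
    rw [abs_of_nonpos (sub_nonpos.2 (hc j)), neg_sub]
  simp only [hv1, hv2, head, tail, sum_sub_distrib, hasum, hcsum, sum_const, card_univ,
    Fintype.card_fin, nsmul_eq_mul, sub_zero]

theorem stmt_3 (n k : ℕ) (hk : 1 ≤ k) (hkn : 2 * k < n)
    (A : ℝ) (hA : 0 < A)
    (a : Fin k → ℝ) (hasum : ∑ i, a i = A) (halarge : ∀ i, A / n < a i)
    (b : Fin (n - k) → ℝ) (hbsum : ∑ j, b j = 0) (hbsmall : ∀ j, b j ≤ A / n)
    (w : Fin n → ℝ)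
    (hw1 : ∀ i : Fin k, w ⟨i, by omega⟩ = a i)
    (hw2 : ∀ j : Fin (n - k), w ⟨k + j, by omega⟩ = b j)
    (m : ℝ) (hm : 1 < m) (hmb : ∀ j, m * b j ≤ A / n)
    (wnew : Fin n → ℝ)
    (hwn1 : ∀ i : Fin k, wnew ⟨i, by omega⟩ = a i)
    (hwn2 : ∀ j : Fin (n - k), wnew ⟨k + j, by omega⟩ = m * b j) :
    bShift wnew = bShift w ∧ bScale wnew = bScale w ∧ ∀ i, bDeq wnew i = bDeq w i := by
  have hd : k + (n - k) = n := by omega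
  have hmbsum : ∑ j, m * b j = 0 := by rw [← mul_sum, hbsum, mul_zero]
  have shift := bShift_eq_of_tail_sum_zero hd hasum hbsum hw1 hw2
  have shift_new := bShift_eq_of_tail_sum_zero hd hasum hmbsum hwn1 hwn2
  have scale_eq : bScale wnew = bScale w := by
    rw [bScale_eq_of_tail_sum_zero hd hasum hmbsum hwn1 hwn2 halarge hmb,
      bScale_eq_of_tail_sum_zero hd hasum hbsum hw1 hw2 halarge hbsmall]
  refine ⟨shift_new.trans shift.symm, scale_eq, fun i => ?_⟩
  have sign_eq : bSign (wnew i - A / n) = bSign (w i - A / n) := by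
    by_cases hi : (i : ℕ) < k
    · rw [show wnew i = w i from (hwn1 ⟨i, hi⟩).trans (hw1 ⟨i, hi⟩).symm]
    · obtain ⟨j, hij⟩ : ∃ j : Fin (n - k), i = ⟨k + j, by omega⟩ :=
        ⟨⟨i - k, by omega⟩, Fin.ext (by simp only; omega)⟩
      rw [hij, hwn2, hw2, bSign, bSign, if_neg (sub_nonpos.2 (hmb j)).not_gt,
        if_neg (sub_nonpos.2 (hbsmall j)).not_gt]
  rw [bDeq, bDeq, scale_eq, shift, shift_new, sign_eq]
end

section
/- Under the part-1 setup, the dequantized value at the small-entry positions is negative: −α(w) + β(w) = (A/n)·(2k/n − 1) < 0. -/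
open Finset

/-- A sum over `Fin n` splits into the sum over the first `k` entries and the remaining ones. -/
theorem sum_fin_split {M : Type*} [AddCommMonoid M] {n k : ℕ} (h : k ≤ n) (f : Fin n → M) :
    ∑ i, f i = ∑ i : Fin k, f ⟨i, by omega⟩ + ∑ j : Fin (n - k), f ⟨k + j, by omega⟩ := by
  rw [← Equiv.sum_comp (finCongr (by omega : k + (n - k) = n)), Fin.sum_univ_add]
  rfl

theorem stmt_5 (n k : ℕ) (hk : 1 ≤ k) (hkn : 2 * k < n)
    (A : ℝ) (hA : 0 < A)
    (a : Fin k → ℝ) (hasum : ∑ i, a i = A) (halarge : ∀ i, A / n < a i)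
    (b : Fin (n - k) → ℝ) (hbsum : ∑ j, b j = 0) (hbsmall : ∀ j, b j ≤ A / n)
    (w : Fin n → ℝ)
    (hw1 : ∀ i : Fin k, w ⟨i, by omega⟩ = a i)
    (hw2 : ∀ j : Fin (n - k), w ⟨k + j, by omega⟩ = b j) :
    -bScale w + bShift w = (A / n) * (2 * (k : ℝ) / n - 1) ∧
      -bScale w + bShift w < 0 := by
  have hn : (0 : ℝ) < n := by exact_mod_cast (by omega : 0 < n)
  have hkn' : 2 * (k : ℝ) < n := by exact_mod_cast hkn
  have hshift : bShift w = A / n := by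
    rw [bShift, sum_fin_split (by omega : k ≤ n)]
    simp only [hw1, hw2, hasum, hbsum]
    ring
  have hlarge : ∑ i, |a i - A / n| = A - k * (A / n) := by
    rw [sum_congr rfl fun i _ => abs_of_pos (sub_pos.2 (halarge i))]
    simp [sum_sub_distrib, hasum]
  have hsmall : ∑ j, |b j - A / n| = (n - k) * (A / n) := by
    rw [sum_congr rfl fun j _ => abs_of_nonpos (sub_nonpos.2 (hbsmall j))]
    simp [sum_sub_distrib, hbsum, Nat.cast_sub (by omega : k ≤ n)]
  have heq : -bScale w + bShift w = (A / n) * (2 * (k : ℝ) / n - 1) := by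
    rw [bScale, sum_fin_split (by omega : k ≤ n)]
    simp only [hw1, hw2, hshift, hlarge, hsmall]
    field_simp
    ring
  refine ⟨heq, heq ▸ mul_neg_of_pos_of_neg (by positivity) ?_⟩
  rw [sub_neg, div_lt_one hn]
  exact hkn'
end

section
/- Under the part-1 setup, the contribution of the large-entry positions to the quantized output is positive but strictly below the true output: 2k·(α(w) + β(w)) = 2kA(3n−2k)/n² and 0 < 2k·(α(w) + β(w)) < 2A. -/
open Finset

/-- Sums over `Fin n` split into the first `k` and the last `n - k` indices. -/
theorem sum_fin_eq_sum_add_sum {n k : ℕ} (h : k ≤ n) (f : Fin n → ℝ) :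
    ∑ i, f i = ∑ i : Fin k, f ⟨i, by omega⟩ + ∑ j : Fin (n - k), f ⟨k + j, by omega⟩ := by
  obtain ⟨m, rfl⟩ := Nat.exists_eq_add_of_le h
  rw [Fin.sum_univ_add]
  congr 1
  exact Fintype.sum_equiv (finCongr (by omega)) _ _ fun j => rfl

theorem stmt_6 (n k : ℕ) (hk : 1 ≤ k) (hkn : 2 * k < n)
    (A : ℝ) (hA : 0 < A)
    (a : Fin k → ℝ) (hasum : ∑ i, a i = A) (halarge : ∀ i, A / n < a i)
    (b : Fin (n - k) → ℝ) (hbsum : ∑ j, b j = 0) (hbsmall : ∀ j, b j ≤ A / n)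
    (w : Fin n → ℝ)
    (hw1 : ∀ i : Fin k, w ⟨i, by omega⟩ = a i)
    (hw2 : ∀ j : Fin (n - k), w ⟨k + j, by omega⟩ = b j) :
    2 * (k : ℝ) * (bScale w + bShift w) = 2 * k * A * (3 * (n : ℝ) - 2 * k) / (n : ℝ) ^ 2 ∧
      0 < 2 * (k : ℝ) * (bScale w + bShift w) ∧
      2 * (k : ℝ) * (bScale w + bShift w) < 2 * A := by
  have hkR : (1 : ℝ) ≤ k := by exact_mod_cast hk
  have hknR : 2 * (k : ℝ) < n := by exact_mod_cast hkn
  have hn : (0 : ℝ) < n := by linarith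
  have hshift : bShift w = A / n := by
    rw [bShift, sum_fin_eq_sum_add_sum (by omega : k ≤ n)]
    simp only [hw1, hw2, hasum, hbsum]
    ring
  have hscale : bScale w = 2 * A * (n - k) / (n : ℝ) ^ 2 := by
    have h1 : ∑ i, |a i - A / n| = A - k * (A / n) := by
      simp [abs_of_pos (sub_pos.2 (halarge _)), sum_sub_distrib, hasum]
    have h2 : ∑ j, |b j - A / n| = (n - k) * (A / n) := by
      simp [abs_of_nonpos (sub_nonpos.2 (hbsmall _)), sum_sub_distrib, hbsum,
        Nat.cast_sub (by omega : k ≤ n)]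
    rw [bScale, sum_fin_eq_sum_add_sum (by omega : k ≤ n)]
    simp only [hw1, hw2, hshift, h1, h2]
    field_simp
    ring
  have heq : 2 * (k : ℝ) * (bScale w + bShift w) =
      2 * k * A * (3 * (n : ℝ) - 2 * k) / (n : ℝ) ^ 2 := by
    rw [hscale, hshift]
    field_simp
    ring
  refine ⟨heq, ?_, ?_⟩
  · rw [heq]
    have : 0 < 3 * (n : ℝ) - 2 * k := by linarith
    positivity
  · rw [heq, div_lt_iff₀ (by positivity)]
    have h : 0 < A * (((n : ℝ) - k) * (n - 2 * k)) :=
      mul_pos hA (mul_pos (by linarith) (by linarith))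
    linarith
end

section
/- Under the part-1 setup, the quantized output before scaling has the closed form ⟨x, deq(w)⟩ = 2A − 4A(n−2k)(n−k)/n², where x ∈ ℝⁿ is the constant vector with every entry 2; in particular the quantization error 2A − ⟨x, deq(w)⟩ = 4A(n−2k)(n−k)/n² is strictly positive. -/
open Finset

theorem stmt_7 (n k : ℕ) (hk : 1 ≤ k) (hkn : 2 * k < n)
    (A : ℝ) (hA : 0 < A)
    (a : Fin k → ℝ) (hasum : ∑ i, a i = A) (halarge : ∀ i, A / n < a i)
    (b : Fin (n - k) → ℝ) (hbsum : ∑ j, b j = 0) (hbsmall : ∀ j, b j ≤ A / n)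
    (w : Fin n → ℝ)
    (hw1 : ∀ i : Fin k, w ⟨i, by omega⟩ = a i)
    (hw2 : ∀ j : Fin (n - k), w ⟨k + j, by omega⟩ = b j)
    (x : Fin n → ℝ) (hx : ∀ i, x i = 2) :
    (∑ i, x i * bDeq w i) = 2 * A - 4 * A * ((n : ℝ) - 2 * k) * ((n : ℝ) - k) / (n : ℝ) ^ 2 ∧
      2 * A - (∑ i, x i * bDeq w i) = 4 * A * ((n : ℝ) - 2 * k) * ((n : ℝ) - k) / (n : ℝ) ^ 2 ∧
      0 < 4 * A * ((n : ℝ) - 2 * k) * ((n : ℝ) - k) / (n : ℝ) ^ 2 := by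
  have hn : (0 : ℝ) < n := by exact_mod_cast (by omega : 0 < n)
  have hkn' : (2 : ℝ) * k < n := by exact_mod_cast hkn
  have hk0 : (0 : ℝ) ≤ k := k.cast_nonneg
  have hle : k ≤ n := by omega
  have hshift : bShift w = A / n := by
    simp only [bShift, sum_fin_split hle w, hw1, hw2, hasum, hbsum]
    ring
  have hscale : bScale w = 2 * A * (n - k) / (n : ℝ) ^ 2 := by
    have h1 (i : Fin k) : |a i - A / n| = a i - A / n :=
      abs_of_pos (sub_pos.2 (halarge i))
    have h2 (j : Fin (n - k)) : |b j - A / n| = A / n - b j := by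
      rw [abs_of_nonpos (sub_nonpos.2 (hbsmall j)), neg_sub]
    simp only [bScale, hshift, sum_fin_split hle fun i => |w i - A / n|, hw1, hw2, h1, h2,
      sum_sub_distrib, hasum, hbsum, sum_const, card_univ, Fintype.card_fin, nsmul_eq_mul,
      Nat.cast_sub hle]
    field_simp
    ring
  have hsum : ∑ i, x i * bDeq w i =
      2 * A - 4 * A * ((n : ℝ) - 2 * k) * ((n : ℝ) - k) / (n : ℝ) ^ 2 := by
    have h1 (i : Fin k) : bSign (a i - A / n) = 1 := if_pos (sub_pos.2 (halarge i))
    have h2 (j : Fin (n - k)) : bSign (b j - A / n) = -1 :=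
      if_neg (not_lt.2 (sub_nonpos.2 (hbsmall j)))
    rw [sum_fin_split hle]
    simp only [hx, bDeq, hscale, hshift, hw1, hw2, h1, h2, sum_const, card_univ,
      Fintype.card_fin, nsmul_eq_mul, Nat.cast_sub hle]
    field_simp
    ring
  refine ⟨hsum, by rw [hsum]; ring, ?_⟩
  have h1 : (0 : ℝ) < n - 2 * k := by linarith
  have h2 : (0 : ℝ) < n - k := by linarith
  positivity
end
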